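/- Let n ≥ 1, b ∈ Mat_n, and γ ∈ ℂ. Suppose p, q : ℂ → Mat_n are twice differentiable, p(z) is invertible for every z, the system p''(z) = −(z/2) p(z) − b p(z) − 2 p(z) q(z) p(z), q''(z) = −(z/2) q(z) − q(z) b − 2 q(z) p(z) q(z) holds for all z, and the first integral q(z) p'(z) − q'(z) p(z) = (γ/2)·I holds for all z. Define f(z) = p'(z) p(z)⁻¹ and h(z) = 2 p(z) q(z). Then f and h satisfy f'(z) = −f(z)² − (z/2)·I − b − h(z) and h'(z) = f(z) h(z) + h(z) f(z) − γ·I for all z. -/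

import Mathlib

attribute [local instance] Matrix.normedAddCommGroup Matrix.normedSpace

/-- Product rule for matrix-valued functions. -/
theorem HasDerivAt.matrix_mul_apply {n : ℕ} {u v : ℂ → Matrix (Fin n) (Fin n) ℂ}
    {u' v' : Matrix (Fin n) (Fin n) ℂ} {z : ℂ} (hu : HasDerivAt u u' z)
    (hv : HasDerivAt v v' z) :
    HasDerivAt (fun w => u w * v w) (u' * v z + u z * v') z :=
  let _ := Matrix.linftyOpNormedRing (n := Fin n) (α := ℂ)
  let _ := Matrix.linftyOpNormedAlgebra (n := Fin n) (R := ℂ) (α := ℂ)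
  @HasDerivAt.mul ℂ _ z (Matrix (Fin n) (Fin n) ℂ) _ _ u v u' v' hu hv

/-- Derivative of the ring inverse of a function valued in a complete normed algebra. -/
theorem HasDerivAt.ringInverse {A : Type*} [NormedRing A] [NormedAlgebra ℂ A] [CompleteSpace A]
    {u : ℂ → A} {u' : A} {z : ℂ} (hu : HasDerivAt u u' z) (hz : IsUnit (u z)) :
    HasDerivAt (fun w => Ring.inverse (u w))
      (-(Ring.inverse (u z) * u' * Ring.inverse (u z))) z := by
  obtain ⟨a, ha⟩ := hz
  have hinv := hasFDerivAt_ringInverse (𝕜 := ℂ) a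
  rw [ha] at hinv
  simpa [← ha, Function.comp_def] using hinv.comp_hasDerivAt z hu

/-- Derivative of the inverse of a matrix-valued function. -/
theorem HasDerivAt.matrix_inv {n : ℕ} {u : ℂ → Matrix (Fin n) (Fin n) ℂ}
    {u' : Matrix (Fin n) (Fin n) ℂ} {z : ℂ} (hu : HasDerivAt u u' z) (hz : IsUnit (u z)) :
    HasDerivAt (fun w => (u w)⁻¹) (-((u z)⁻¹ * u' * (u z)⁻¹)) z := by
  simp only [Matrix.nonsing_inv_eq_ringInverse]
  have hcomplete : CompleteSpace (Matrix (Fin n) (Fin n) ℂ) := FiniteDimensional.complete ℂ _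
  exact @HasDerivAt.ringInverse (Matrix (Fin n) (Fin n) ℂ) Matrix.linftyOpNormedRing
    Matrix.linftyOpNormedAlgebra hcomplete u u' z hu hz

/-- for solutions of the reduced NLS system with scalar first integral
`q p' − q' p = (γ/2) I`, the variables `f = p' p⁻¹`, `h = 2pq` satisfy
`f' = −f² − z/2 − b − h`, `h' = fh + hf − γ`. -/
theorem matrixNLS_fh_system (n : ℕ) (hn : 1 ≤ n)
    (b : Matrix (Fin n) (Fin n) ℂ) (γ : ℂ)
    (p q : ℂ → Matrix (Fin n) (Fin n) ℂ)
    (hp : Differentiable ℂ p) (hp' : Differentiable ℂ (deriv p))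
    (hq : Differentiable ℂ q) (hq' : Differentiable ℂ (deriv q))
    (hinv : ∀ z : ℂ, IsUnit (p z))
    (hpeq : ∀ z : ℂ, deriv (deriv p) z =
      -((z/2) • p z) - b * p z - 2 * (p z * q z * p z))
    (hqeq : ∀ z : ℂ, deriv (deriv q) z =
      -((z/2) • q z) - q z * b - 2 * (q z * p z * q z))
    (hint : ∀ z : ℂ, q z * deriv p z - deriv q z * p z
      = (γ/2) • (1 : Matrix (Fin n) (Fin n) ℂ)) :
    (∀ z : ℂ, deriv (fun w => deriv p w * (p w)⁻¹) z =
      -(deriv p z * (p z)⁻¹) ^ 2 - (z/2) • (1 : Matrix (Fin n) (Fin n) ℂ) - b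
        - 2 * (p z * q z)) ∧
    (∀ z : ℂ, deriv (fun w => 2 * (p w * q w)) z =
      (deriv p z * (p z)⁻¹) * (2 * (p z * q z)) + (2 * (p z * q z)) * (deriv p z * (p z)⁻¹)
        - γ • (1 : Matrix (Fin n) (Fin n) ℂ)) := by
  have hdet (z : ℂ) : IsUnit (p z).det := (Matrix.isUnit_iff_isUnit_det _).1 (hinv z)
  have hcancel (z : ℂ) : p z * (p z)⁻¹ = 1 := Matrix.mul_nonsing_inv _ (hdet z)
  refine ⟨fun z => ?_, fun z => ?_⟩
  · have hd1 : HasDerivAt p (deriv p z) z := (hp z).hasDerivAt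
    have hd2 : HasDerivAt (deriv p) (deriv (deriv p) z) z := (hp' z).hasDerivAt
    rw [hpeq z] at hd2
    refine (hd2.matrix_mul_apply (hd1.matrix_inv (hinv z))).deriv.trans ?_
    simp only [sub_mul, neg_mul, smul_mul_assoc, mul_assoc, hcancel, mul_one, mul_neg, pow_two]
    abel
  · have hq1 : q z * deriv p z * (p z)⁻¹ = deriv q z + (γ / 2) • (p z)⁻¹ := by
      rw [sub_eq_iff_eq_add.1 (hint z), add_mul, mul_assoc (deriv q z), hcancel]
      simp [add_comm]
    have hpq : p z * q z * (deriv p z * (p z)⁻¹) = p z * deriv q z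
        + (γ / 2) • (1 : Matrix (Fin n) (Fin n) ℂ) := by
      rw [mul_assoc, ← mul_assoc (q z), hq1, mul_add, mul_smul_comm, hcancel]
    have hfp : deriv p z * (p z)⁻¹ * (p z * q z) = deriv p z * q z := by
      rw [mul_assoc, ← mul_assoc (p z)⁻¹, Matrix.nonsing_inv_mul _ (hdet z), one_mul]
    have hγ : γ • (1 : Matrix (Fin n) (Fin n) ℂ)
        = (γ / 2) • (1 : Matrix (Fin n) (Fin n) ℂ)
          + (γ / 2) • (1 : Matrix (Fin n) (Fin n) ℂ) := by
      rw [← add_smul, add_halves]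
    have hd := (hp z).hasDerivAt.matrix_mul_apply (hq z).hasDerivAt
    simp only [two_mul]
    refine (hd.add hd).deriv.trans ?_
    rw [mul_add, add_mul (p z * q z), hfp, hpq, hγ]
    abel
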